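/- arXiv:1802.01322 — 9 statements merged into one kernel-verified Lean document; each statement's English description precedes it below -/
import Mathlib

section
/- (Poincaré function for Riemannian metrics on an n-dimensional manifold.) (i) Let n = 2 and h_0 = h_1 = 0, h_2 = h_3 = 1, h_k = k−1 for k ≥ 4; then for every real z with 0 < |z| < 1, ∑_{k=0}^∞ h_k z^k = z^2(1 − z + 2z^2 − z^3)/(1−z)^2. (ii) Let n ≥ 3 and h_0 = h_1 = 0, h_2 = (1/2)·C(n,3)·(n+3), and h_k = C(n+1,2)·C(n+k−1,k) − n·C(n+k,k+1) for k ≥ 3; then for every real z with 0 < |z| < 1, ∑_{k=0}^∞ h_k z^k = n/z + C(n,2)·(1 − z^2) − (1/(1−z)^n)·( n/z − C(n+1,2) ). -/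
theorem Nat.cast_choose_three (n : ℕ) :
    (n.choose 3 : ℝ) = n * (n - 1) * (n - 2) / 6 := by
  induction n with
  | zero => simp
  | succ n ih =>
    rw [Nat.choose_succ_succ' n 2, Nat.cast_add, ih, Nat.cast_choose_two]
    push_cast
    ring

/-- The negative binomial series. -/
theorem hasSum_choose_add_sub_one {n : ℕ} (hn : n ≠ 0) {z : ℝ} (hz : |z| < 1) :
    HasSum (fun k : ℕ => ((n + k - 1).choose k : ℝ) * z ^ k) (1 / (1 - z) ^ n) := by
  obtain ⟨m, rfl⟩ := Nat.exists_eq_succ_of_ne_zero hn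
  convert! hasSum_choose_mul_geometric_of_norm_lt_one m (r := z) (by simpa using hz) using 4 with k
  rw [show m.succ + k - 1 = k + m by omega, Nat.choose_symm_add]

/-- The negative binomial series with its constant term removed, divided by `z`. -/
theorem hasSum_choose_add {n : ℕ} (hn : n ≠ 0) {z : ℝ} (hz₀ : z ≠ 0) (hz : |z| < 1) :
    HasSum (fun k : ℕ => ((n + k).choose (k + 1) : ℝ) * z ^ k) ((1 / (1 - z) ^ n - 1) / z) := by
  have h := ((hasSum_nat_add_iff' 1).mpr (hasSum_choose_add_sub_one hn hz)).div_const z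
  convert! h using 1
  · funext k
    rw [show n + (k + 1) - 1 = n + k by omega, pow_succ]
    field_simp
  · simp


/-- Poincaré function for Riemannian metrics on an n-dimensional manifold:
(i) the case n = 2, (ii) the case n ≥ 3. -/
theorem poincare_riemannian_metrics :
    (∀ h : ℕ → ℝ,
      h 0 = 0 → h 1 = 0 → h 2 = 1 → h 3 = 1 →
      (∀ k, 4 ≤ k → h k = (k : ℝ) - 1) →
      ∀ z : ℝ, 0 < |z| → |z| < 1 →
        HasSum (fun k : ℕ => h k * z ^ k)
          (z ^ 2 * (1 - z + 2 * z ^ 2 - z ^ 3) / (1 - z) ^ 2)) ∧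
    (∀ n : ℕ, 3 ≤ n → ∀ h : ℕ → ℝ,
      h 0 = 0 → h 1 = 0 →
      h 2 = (1 / 2) * (n.choose 3 : ℝ) * ((n : ℝ) + 3) →
      (∀ k, 3 ≤ k → h k = ((n + 1).choose 2 : ℝ) * ((n + k - 1).choose k : ℝ)
          - (n : ℝ) * ((n + k).choose (k + 1) : ℝ)) →
      ∀ z : ℝ, 0 < |z| → |z| < 1 →
        HasSum (fun k : ℕ => h k * z ^ k)
          ((n : ℝ) / z + (n.choose 2 : ℝ) * (1 - z ^ 2)
            - (1 / (1 - z) ^ n) * ((n : ℝ) / z - ((n + 1).choose 2 : ℝ)))) := by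
  refine ⟨?_, ?_⟩
  · intro h h0 h1 h2 h3 hk z hz₀ hz
    have hz1 : (1 : ℝ) - z ≠ 0 := sub_ne_zero.mpr (abs_lt.mp hz).2.ne'
    have hgeom := hasSum_geometric_of_abs_lt_one hz
    have hcoe := hasSum_coe_mul_geometric_of_norm_lt_one (r := z) (by simpa using hz)
    have hsum := ((hcoe.sub hgeom).add (hasSum_ite_eq 0 (1 : ℝ))).sub (hasSum_ite_eq 3 (z ^ 3))
    convert! hsum using 1
    · funext k
      match k with
      | 0 => simp [h0]
      | 1 => simp [h1]
      | 2 => norm_num [h2]; ring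
      | 3 => norm_num [h3]; ring
      | k + 4 =>
        rw [hk (k + 4) (by omega), if_neg (by omega), if_neg (by omega)]
        ring
    · field_simp
      ring
  · intro n hn h h0 h1 h2 hk z hz₀ hz
    have hz0 : z ≠ 0 := abs_pos.mp hz₀
    have hn0 : n ≠ 0 := by omega
    have hsum := ((((hasSum_choose_add_sub_one hn0 hz).mul_left ((n + 1).choose 2 : ℝ)).sub
      ((hasSum_choose_add hn0 hz0 hz).mul_left (n : ℝ))).add
      (hasSum_ite_eq 0 (n.choose 2 : ℝ))).sub (hasSum_ite_eq 2 ((n.choose 2 : ℝ) * z ^ 2))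
    convert! hsum using 1
    · funext k
      match k with
      | 0 =>
        simp [h0, Nat.cast_choose_two]
        ring
      | 1 =>
        simp [h1, Nat.cast_choose_two]
        ring
      | 2 =>
        rw [h2, show n + 2 - 1 = n + 1 by omega, if_neg (by omega), if_pos rfl]
        simp only [Nat.reduceAdd, Nat.cast_choose_three, Nat.cast_choose_two]
        push_cast
        ring
      | k + 3 =>
        rw [hk (k + 3) (by omega), if_neg (by omega), if_neg (by omega)]
        ring
    · ring
end

section
/- (Poincaré function for Einstein metrics on an n-dimensional manifold, n ≥ 4.) Let n ≥ 4 and define h_0 = h_1 = 0, h_2 = (1/12)·(n^2−1)·(n^2−12), and h_k = (k−1)·n·(n+k−1)·(n+2k−2) / (2(k+1)(n−2)) · C(n+k−4,k) for k ≥ 3. Then for every real z with 0 < |z| < 1, ∑_{k=0}^∞ h_k z^k = n(z+1)((n+1)z − 2(z^2+1)) / (2z(1−z)^{n−1}) − C(n,2)·(z^2 − 1) + n/z + z^2. -/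
/-- The third-order numerator pattern `-2, n - 1, n - 1, -2` applied to consecutive coefficients of
`(1 - z) ^ (-(n - 1))`, with `n = m + 4`, collapses to a single binomial coefficient. -/
lemma choose_combination (m K : ℕ) (hK : 1 ≤ K) :
    ((m : ℝ) + 4) / 2 * (-2 * ((m + K + 3).choose (m + 2) : ℝ)
      + (m + 3) * ((m + K + 2).choose (m + 2) : ℝ)
      + (m + 3) * ((m + K + 1).choose (m + 2) : ℝ) - 2 * ((m + K).choose (m + 2) : ℝ))
    = ((K : ℝ) - 1) * (m + 4) * (m + 4 + K - 1) * (m + 4 + 2 * K - 2)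
        / (2 * (K + 1) * (m + 4 - 2)) * ((m + K).choose m : ℝ) := by
  have hb : ((m + K).choose (m + 1) : ℝ) = (m + K).choose m * K / (m + 1) := by
    rw [eq_div_iff (by positivity)]
    have := Nat.choose_succ_right_eq (m + K) m
    rw [Nat.add_sub_cancel_left] at this
    exact_mod_cast this
  have hc : ((m + K).choose (m + 2) : ℝ) = (m + K).choose (m + 1) * (K - 1) / (m + 2) := by
    rw [eq_div_iff (by positivity)]
    have := Nat.choose_succ_right_eq (m + K) (m + 1)
    rw [show m + K - (m + 1) = K - 1 by lia] at this
    have := congrArg (Nat.cast (R := ℝ)) this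
    push_cast [Nat.cast_sub hK] at this
    linear_combination this
  have he : ((m + K + 1).choose m : ℝ) = (m + K).choose m * (m + K + 1) / (K + 1) := by
    rw [eq_div_iff (by positivity)]
    have := Nat.choose_mul_succ_eq (m + K) m
    rw [show m + K + 1 - m = K + 1 by lia] at this
    exact_mod_cast this.symm
  rw [Nat.choose_succ_succ' (m + K + 2) (m + 1), Nat.choose_succ_succ' (m + K + 1) (m + 1),
    Nat.choose_succ_succ' (m + K + 1) m, Nat.choose_succ_succ' (m + K) (m + 1),
    Nat.choose_succ_succ' (m + K) m]
  push_cast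
  rw [he, hc, hb, show (m : ℝ) + 4 - 2 = m + 2 by ring]
  field_simp
  ring

/-- Poincaré function for Einstein metrics on an n-dimensional manifold, n ≥ 4. -/
theorem poincare_einstein_metrics (n : ℕ) (hn : 4 ≤ n) (h : ℕ → ℝ)
    (h_0 : h 0 = 0) (h_1 : h 1 = 0)
    (h_2 : h 2 = (1 / 12) * ((n : ℝ) ^ 2 - 1) * ((n : ℝ) ^ 2 - 12))
    (h_ge3 : ∀ k, 3 ≤ k → h k =
      ((k : ℝ) - 1) * (n : ℝ) * ((n : ℝ) + (k : ℝ) - 1) * ((n : ℝ) + 2 * (k : ℝ) - 2)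
        / (2 * ((k : ℝ) + 1) * ((n : ℝ) - 2)) * ((n + k - 4).choose k : ℝ))
    (z : ℝ) (hz0 : 0 < |z|) (hz1 : |z| < 1) :
    HasSum (fun k : ℕ => h k * z ^ k)
      ((n : ℝ) * (z + 1) * (((n : ℝ) + 1) * z - 2 * (z ^ 2 + 1))
          / (2 * z * (1 - z) ^ (n - 1))
        - (n.choose 2 : ℝ) * (z ^ 2 - 1) + (n : ℝ) / z + z ^ 2) := by
  obtain ⟨m, rfl⟩ := Nat.exists_eq_add_of_le' hn
  have hz : z ≠ 0 := abs_pos.mp hz0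
  have hz' : 1 - z ≠ 0 := (sub_pos.mpr (lt_of_abs_lt hz1)).ne'
  have hF := hasSum_choose_mul_geometric_of_norm_lt_one (𝕜 := ℝ) (m + 2) (r := z) hz1
  have shift (i : ℕ) := (hasSum_nat_add_iff' i).mpr hF
  rw [← hasSum_nat_add_iff' 3]
  have key := (((((shift 4).mul_left (-2 / z)).add ((shift 3).mul_left ((m : ℝ) + 3))).add
    ((shift 2).mul_left (((m : ℝ) + 3) * z))).add ((shift 1).mul_left (-2 * z ^ 2))).mul_left
    (((m : ℝ) + 4) / 2)
  convert! key using 1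
  · funext k
    have := choose_combination m (k + 3) (by lia)
    rw [h_ge3 (k + 3) (by lia), show m + 4 + (k + 3) - 4 = m + (k + 3) by lia,
      ← Nat.choose_symm_add (a := m) (b := k + 3)]
    push_cast at this ⊢
    rw [← this, show k + 4 + (m + 2) = m + (k + 3) + 3 by lia,
      show k + 3 + (m + 2) = m + (k + 3) + 2 by lia,
      show k + 2 + (m + 2) = m + (k + 3) + 1 by lia,
      show k + 1 + (m + 2) = m + (k + 3) by lia]
    field_simp
    ring
  · have c1 : ((1 + (m + 2)).choose (m + 2) : ℝ) = m + 3 := by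
      rw [add_comm 1, Nat.choose_succ_self_right]
      push_cast
      ring
    have c2 : ((2 + (m + 2)).choose (m + 2) : ℝ) = (m + 3) * (m + 4) / 2 := by
      rw [Nat.choose_symm_add.symm, Nat.cast_choose_two]
      push_cast
      ring
    have c3 : ((3 + (m + 2)).choose (m + 2) : ℝ) = (m + 3) * (m + 4) * (m + 5) / 6 := by
      have := Nat.choose_succ_right_eq (3 + (m + 2)) 2
      rw [show 3 + (m + 2) - 2 = m + 3 by lia, Nat.choose_symm_add] at this
      have := congrArg (Nat.cast (R := ℝ)) this
      push_cast [Nat.cast_choose_two] at this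
      linear_combination this / 3
    rw [Nat.cast_choose_two]
    simp only [Finset.sum_range_succ, Finset.sum_range_zero, c1, c2, c3, h_0, h_1, h_2, zero_add,
      Nat.choose_self, show m + 4 - 1 = m + 2 + 1 by lia]
    push_cast
    field_simp
    ring
end

section
/- (Poincaré function for hyper-Kähler metrics on a 4n-dimensional manifold.) Let n ≥ 1 and define h_0 = h_1 = 0, h_2 = (1/6)·n·(n+3)·(2n−1)·(2n+1), and h_k = 2·∑_{i=0}^{n} C(2n+k−i, k)·(n−i) − C(2n+k+1, k+2) − 2·C(n+k+1, k+2) for k ≥ 3. Then for every real z with 0 < |z| < 1, ∑_{k=0}^∞ h_k z^k = 2n/(z (1−z)^{2n+1}) − 3/(z^2 (1−z)^{2n}) − n(2n+1)(z^2 − 1) + (4nz + 3)/z^2. -/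
theorem cast_choose_succ_mul (M k : ℕ) :
    ((M + k).choose (k + 1) : ℝ) * ((k : ℝ) + 1) = ((M + k).choose k : ℝ) * (M : ℝ) := by
  have := Nat.choose_succ_right_eq (M + k) k
  rw [Nat.add_sub_cancel] at this
  exact_mod_cast this

theorem sum_range_mul_choose (n k J : ℕ) :
    ∑ j ∈ Finset.range (J + 1), (j : ℝ) * ((n + j + k).choose k : ℝ) =
      ((k : ℝ) + 1) * (((n + J + k + 1).choose (k + 2) : ℝ) - ((n + k).choose (k + 2) : ℝ))
      - (n : ℝ) * (((n + J + k + 1).choose (k + 1) : ℝ) - ((n + k).choose (k + 1) : ℝ)) := by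
  induction J with
  | zero =>
    have e := cast_choose_succ_mul n k
    simp only [zero_add, Finset.sum_range_one, Nat.cast_zero, zero_mul, add_zero]
    rw [Nat.choose_succ_succ' (n + k) (k + 1), Nat.choose_succ_succ' (n + k) k]
    push_cast
    linear_combination -e
  | succ J ih =>
    have e := cast_choose_succ_mul (n + (J + 1)) k
    rw [Finset.sum_range_succ, ih, Nat.choose_succ_succ' (n + (J + 1) + k) (k + 1),
      Nat.choose_succ_succ' (n + (J + 1) + k) k]
    rw [show n + J + k + 1 = n + (J + 1) + k by ring]
    push_cast at e ⊢
    linear_combination -e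

theorem two_mul_sum_choose_sub_choose (n k : ℕ) :
    2 * (∑ i ∈ Finset.range (n + 1), ((2 * n + k - i).choose k : ℝ) * ((n - i : ℕ) : ℝ))
      - ((2 * n + k + 1).choose (k + 2) : ℝ) - 2 * ((n + k + 1).choose (k + 2) : ℝ) =
      2 * (n : ℝ) * ((2 * n + k + 1).choose (k + 1) : ℝ)
        - 3 * ((2 * n + k + 1).choose (k + 2) : ℝ) := by
  have hs : ∑ i ∈ Finset.range (n + 1), ((2 * n + k - i).choose k : ℝ) * ((n - i : ℕ) : ℝ) =
      ∑ j ∈ Finset.range (n + 1), (j : ℝ) * ((n + j + k).choose k : ℝ) := by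
    rw [← Finset.sum_range_reflect]
    refine Finset.sum_congr rfl fun j hj => ?_
    have hj' := Finset.mem_range.mp hj
    rw [show 2 * n + k - (n + 1 - 1 - j) = n + j + k by omega,
      show n - (n + 1 - 1 - j) = j by omega, mul_comm]
  rw [hs, sum_range_mul_choose, ← two_mul, Nat.choose_succ_succ' (n + k) (k + 1)]
  have e₁ := cast_choose_succ_mul (2 * n) (k + 1)
  have e₂ : ((n + k).choose (k + 2) : ℝ) * ((k : ℝ) + 2)
      = ((n + k).choose (k + 1) : ℝ) * ((n : ℝ) - 1) := by
    rcases n with _ | m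
    · simp [Nat.choose_eq_zero_of_lt]
    · have e := cast_choose_succ_mul m (k + 1)
      rw [show m + (k + 1) = m + 1 + k by ring] at e
      push_cast at e ⊢
      linear_combination e
  rw [← add_assoc] at e₁
  push_cast at e₁ ⊢
  linear_combination 2 * e₁ - 2 * e₂

theorem cast_choose_three (m : ℕ) :
    ((m + 3).choose 3 : ℝ) = ((m : ℝ) + 3) * ((m : ℝ) + 2) * ((m : ℝ) + 1) / 6 := by
  have e₁ := cast_choose_succ_mul (m + 1) 2
  have e₂ := cast_choose_succ_mul (m + 2) 1
  simp only [add_assoc, Nat.reduceAdd, Nat.choose_one_right] at e₁ e₂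
  push_cast at e₁ e₂
  linear_combination e₁ / 3 + ((m : ℝ) + 1) / 6 * e₂

theorem hasSum_choose_sub_choose (n : ℕ) (hn : 1 ≤ n) (z : ℝ) (hz0 : z ≠ 0) (hz1 : |z| < 1) :
    HasSum (fun k : ℕ => (2 * (n : ℝ) * ((2 * n + k + 1).choose (k + 1) : ℝ)
        - 3 * ((2 * n + k + 1).choose (k + 2) : ℝ)) * z ^ k)
      (2 * (n : ℝ) / (z * (1 - z) ^ (2 * n + 1)) - 3 / (z ^ 2 * (1 - z) ^ (2 * n))
        + (4 * (n : ℝ) * z + 3) / z ^ 2) := by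
  have hz : 1 - z ≠ 0 := by linarith [(abs_lt.mp hz1).2]
  have hF := (hasSum_nat_add_iff' 1).mpr
    (hasSum_choose_mul_geometric_of_norm_lt_one (2 * n) (r := z) hz1)
  have hG := (hasSum_nat_add_iff' 2).mpr
    (hasSum_choose_mul_geometric_of_norm_lt_one (2 * n - 1) (r := z) hz1)
  convert (hF.mul_left (2 * (n : ℝ) / z)).sub (hG.mul_left (3 / z ^ 2)) using 1
  · rfl
  · funext k
    have e₁ : (k + 1 + 2 * n).choose (2 * n) = (2 * n + k + 1).choose (k + 1) := by
      rw [show 2 * n + k + 1 = k + 1 + 2 * n by ring, Nat.choose_symm_add]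
    have e₂ : (k + 2 + (2 * n - 1)).choose (2 * n - 1) = (2 * n + k + 1).choose (k + 2) := by
      rw [show 2 * n + k + 1 = k + 2 + (2 * n - 1) by omega, Nat.choose_symm_add]
    rw [e₁, e₂]
    field_simp
    ring
  · rw [Finset.sum_range_one, Finset.sum_range_succ, Finset.sum_range_one,
      show 2 * n - 1 + 1 = 2 * n by omega, show 1 + (2 * n - 1) = 2 * n - 1 + 1 by omega,
      Nat.choose_succ_self_right, show 2 * n - 1 + 1 = 2 * n by omega]
    simp only [zero_add, Nat.choose_self, pow_zero, pow_one]
    push_cast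
    field_simp
    ring

/-- Poincaré function for hyper-Kähler metrics on a 4n-dimensional manifold, n ≥ 1. -/
theorem poincare_hyperkahler_metrics (n : ℕ) (hn : 1 ≤ n) (h : ℕ → ℝ)
    (h_0 : h 0 = 0) (h_1 : h 1 = 0)
    (h_2 : h 2 = (1 / 6) * (n : ℝ) * ((n : ℝ) + 3) * (2 * (n : ℝ) - 1) * (2 * (n : ℝ) + 1))
    (h_ge3 : ∀ k, 3 ≤ k → h k =
      2 * (∑ i ∈ Finset.range (n + 1), ((2 * n + k - i).choose k : ℝ) * ((n - i : ℕ) : ℝ))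
      - ((2 * n + k + 1).choose (k + 2) : ℝ) - 2 * ((n + k + 1).choose (k + 2) : ℝ))
    (z : ℝ) (hz0 : 0 < |z|) (hz1 : |z| < 1) :
    HasSum (fun k : ℕ => h k * z ^ k)
      (2 * (n : ℝ) / (z * (1 - z) ^ (2 * n + 1)) - 3 / (z ^ 2 * (1 - z) ^ (2 * n))
        - (n : ℝ) * (2 * (n : ℝ) + 1) * (z ^ 2 - 1) + (4 * (n : ℝ) * z + 3) / z ^ 2) := by
  have hB := hasSum_choose_sub_choose n hn z (abs_pos.mp hz0) hz1
  have hC := (hB.add (hasSum_ite_eq 0 ((n : ℝ) * (2 * n + 1)))).sub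
    (hasSum_ite_eq 2 ((n : ℝ) * (2 * n + 1) * z ^ 2))
  convert hC using 1
  · rfl
  · funext k
    have e := cast_choose_succ_mul (2 * n) (k + 1)
    rw [← add_assoc] at e
    match k with
    | 0 =>
      simp only [add_zero, zero_add, Nat.choose_one_right] at e ⊢
      push_cast at e
      simp [h_0]
      linear_combination 3 / 2 * e
    | 1 =>
      simp only [add_assoc, Nat.reduceAdd] at e ⊢
      push_cast at e
      simp [h_1]
      left
      linear_combination -e
    | 2 =>
      have e' := cast_choose_three (2 * n)
      simp only [add_assoc, Nat.reduceAdd] at e e' ⊢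
      push_cast at e e'
      simp [h_2]
      linear_combination (3 / 4 * e - n / 2 * e') * z ^ 2
    | k + 3 =>
      rw [h_ge3 (k + 3) (by omega), two_mul_sum_choose_sub_choose]
      simp
  · ring
end

section
/- (Poincaré function for general linear connections on an n-dimensional manifold.) (i) Let n = 2 and h_0 = 0, h_1 = 6, h_k = 6k + 2 for k ≥ 2; then for every real z with 0 < |z| < 1, ∑_{k=0}^∞ h_k z^k = 2z(3 + z − z^2)/(1−z)^2. (ii) Let n ≥ 3 and h_0 = (1/2)·n^2·(n−3), h_k = n^3·C(n+k−1, k) − n·C(n+k+1, k+2) for k ≥ 1; then for every real z with 0 < |z| < 1, ∑_{k=0}^∞ h_k z^k = n(n^2 z^2 − 1)/(z^2 (1−z)^n) − n^2 + n(nz + 1)/z^2. -/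
theorem hasSum_choose_mul_pow_of_abs_lt_one (n : ℕ) (hn : 1 ≤ n) {z : ℝ} (hz : |z| < 1) :
    HasSum (fun k : ℕ => ((n + k - 1).choose k : ℝ) * z ^ k) (1 / (1 - z) ^ n) := by
  obtain ⟨m, rfl⟩ : ∃ m, n = m + 1 := ⟨n - 1, by omega⟩
  refine (hasSum_choose_mul_geometric_of_norm_lt_one m (r := z) hz).congr_fun ?_
  intro k
  rw [show m + 1 + k - 1 = k + m by omega, Nat.choose_symm_add]


/-- Poincaré function for general linear connections on an n-dimensional manifold:
(i) the case n = 2, (ii) the case n ≥ 3. -/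
theorem poincare_linear_connections :
    (∀ h : ℕ → ℝ,
      h 0 = 0 → h 1 = 6 →
      (∀ k, 2 ≤ k → h k = 6 * (k : ℝ) + 2) →
      ∀ z : ℝ, 0 < |z| → |z| < 1 →
        HasSum (fun k : ℕ => h k * z ^ k)
          (2 * z * (3 + z - z ^ 2) / (1 - z) ^ 2)) ∧
    (∀ n : ℕ, 3 ≤ n → ∀ h : ℕ → ℝ,
      h 0 = (1 / 2) * (n : ℝ) ^ 2 * ((n : ℝ) - 3) →
      (∀ k, 1 ≤ k → h k = (n : ℝ) ^ 3 * ((n + k - 1).choose k : ℝ)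
        - (n : ℝ) * ((n + k + 1).choose (k + 2) : ℝ)) →
      ∀ z : ℝ, 0 < |z| → |z| < 1 →
        HasSum (fun k : ℕ => h k * z ^ k)
          ((n : ℝ) * ((n : ℝ) ^ 2 * z ^ 2 - 1) / (z ^ 2 * (1 - z) ^ n)
            - (n : ℝ) ^ 2 + (n : ℝ) * ((n : ℝ) * z + 1) / z ^ 2)) := by
  refine ⟨fun h h0 h1 hk z _ hz => ?_, fun n hn h h0 hk z hz0 hz => ?_⟩
  · have hz1 : 1 - z ≠ 0 := (sub_pos.mpr (abs_lt.mp hz).2).ne'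
    have hlin := (hasSum_coe_mul_geometric_of_norm_lt_one (r := z) hz).mul_left 6
    have hgeom := (hasSum_geometric_of_norm_lt_one (ξ := z) hz).mul_left 2
    have hsum := ((hlin.add hgeom).sub (hasSum_ite_eq 0 (2 : ℝ))).sub (hasSum_ite_eq 1 (2 * z))
    convert! hsum using 1
    · funext k
      rcases k with _ | _ | k
      · simp [h0]
      · simp [h1]
      · rw [hk (k + 2) (by omega)]
        simp
        ring
    · field_simp
      ring
  · have hz1 : 1 - z ≠ 0 := (sub_pos.mpr (abs_lt.mp hz).2).ne'
    have hz2 : z ≠ 0 := abs_pos.mp hz0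
    have hbase := hasSum_choose_mul_pow_of_abs_lt_one n (by omega) hz
    have hshift := ((hasSum_nat_add_iff' 2).mpr hbase).mul_left ((n : ℝ) / z ^ 2)
    have hsum := ((hbase.mul_left ((n : ℝ) ^ 3)).sub hshift).sub (hasSum_ite_eq 0 ((n : ℝ) ^ 2))
    convert! hsum using 1
    · funext k
      rw [show n + (k + 2) - 1 = n + k + 1 by omega]
      rcases k with _ | k
      · have hchoose : ((n + 1).choose 2 : ℝ) = ((n : ℝ) + 1) * n / 2 := by
          rw [Nat.cast_choose_two]
          push_cast
          ring
        simp [h0, hchoose]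
        field_simp
        ring
      · rw [hk (k + 1) (by omega)]
        simp
        field_simp
        ring
    · simp [Finset.sum_range_succ]
      field_simp
      ring
end

section
/- (Poincaré function for symmetric linear connections on an n-dimensional manifold.) Let n ≥ 2 and define h_0 = 0, h_1 = (1/3)·n^2·(n^2−4) + δ, h_2 = n·C(n+1,2)^2 − n·C(n+3,4) − δ, and h_k = n·C(n+1,2)·C(n+k−1, k) − n·C(n+k+1, k+2) for k ≥ 3, where δ = 1 if n = 2 and δ = 0 if n ≥ 3. Then for every real z with 0 < |z| < 1: if n = 2, ∑_{k=0}^∞ h_k z^k = z(1 + 5z − z^2 − z^3)/(1−z)^2; if n ≥ 3, ∑_{k=0}^∞ h_k z^k = n(n(n+1)z^2 − 2)/(2 z^2 (1−z)^n) − n^2 z + n(1 + nz)/z^2. -/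
theorem hasSum_choose_mul_pow {n : ℕ} (hn : 1 ≤ n) {z : ℝ} (hz : |z| < 1) :
    HasSum (fun k : ℕ => ((n + k - 1).choose k : ℝ) * z ^ k) (1 / (1 - z) ^ n) := by
  obtain ⟨m, rfl⟩ := Nat.exists_eq_add_of_le' hn
  refine (hasSum_choose_mul_geometric_of_norm_lt_one m
    (by rwa [Real.norm_eq_abs] : ‖z‖ < 1)).congr_fun fun k => ?_
  rw [show m + 1 + k - 1 = k + m by omega, Nat.choose_symm_add]

theorem hasSum_choose_add_two_mul_pow {n : ℕ} (hn : 1 ≤ n) {z : ℝ} (hz0 : z ≠ 0)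
    (hz : |z| < 1) :
    HasSum (fun k : ℕ => ((n + k + 1).choose (k + 2) : ℝ) * z ^ k)
      ((1 / (1 - z) ^ n - (1 + n * z)) / z ^ 2) := by
  have hs := ((hasSum_nat_add_iff' 2).2 (hasSum_choose_mul_pow hn hz)).div_const (z ^ 2)
  simp only [Finset.sum_range_succ, Finset.sum_range_zero, add_tsub_cancel_right, zero_add,
    Nat.choose_zero_right, Nat.choose_one_right, Nat.cast_one, pow_zero, pow_one, mul_one] at hs
  refine hs.congr_fun fun k => ?_
  rw [show n + (k + 2) - 1 = n + k + 1 by omega, pow_add]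
  field_simp

theorem cast_choose_add_two_three (n : ℕ) :
    ((n + 2).choose 3 : ℝ) = n * (n + 1) * (n + 2) / 6 := by
  rw [Nat.cast_choose_eq_ascPochhammer_div]
  simp [ascPochhammer_succ_eval, Nat.factorial]

/-- Poincaré function for symmetric linear connections on an n-dimensional manifold, n ≥ 2. -/
theorem poincare_symmetric_connections (n : ℕ) (hn : 2 ≤ n) (h : ℕ → ℝ)
    (h_0 : h 0 = 0)
    (h_1 : h 1 = (1 / 3) * (n : ℝ) ^ 2 * ((n : ℝ) ^ 2 - 4) + (if n = 2 then (1 : ℝ) else 0))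
    (h_2 : h 2 = (n : ℝ) * ((n + 1).choose 2 : ℝ) ^ 2 - (n : ℝ) * ((n + 3).choose 4 : ℝ)
      - (if n = 2 then (1 : ℝ) else 0))
    (h_ge3 : ∀ k, 3 ≤ k → h k = (n : ℝ) * ((n + 1).choose 2 : ℝ) * ((n + k - 1).choose k : ℝ)
      - (n : ℝ) * ((n + k + 1).choose (k + 2) : ℝ))
    (z : ℝ) (hz0 : 0 < |z|) (hz1 : |z| < 1) :
    (n = 2 → HasSum (fun k : ℕ => h k * z ^ k)
      (z * (1 + 5 * z - z ^ 2 - z ^ 3) / (1 - z) ^ 2)) ∧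
    (3 ≤ n → HasSum (fun k : ℕ => h k * z ^ k)
      ((n : ℝ) * ((n : ℝ) * ((n : ℝ) + 1) * z ^ 2 - 2) / (2 * z ^ 2 * (1 - z) ^ n)
        - (n : ℝ) ^ 2 * z + (n : ℝ) * (1 + (n : ℝ) * z) / z ^ 2)) := by
  have hz : z ≠ 0 := abs_pos.1 hz0
  have hz' : 1 - z ≠ 0 := (sub_pos.2 (abs_lt.1 hz1).2).ne'
  have hN : ((n + 1).choose 2 : ℝ) = n * (n + 1) / 2 := by
    rw [Nat.cast_choose_two]; push_cast; ring
  set δ : ℝ := if n = 2 then 1 else 0 with hδ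
  have hmain := (((hasSum_choose_mul_pow (by omega : 1 ≤ n) hz1).mul_left
    ((n : ℝ) * ((n + 1).choose 2 : ℝ))).sub
    ((hasSum_choose_add_two_mul_pow (by omega : 1 ≤ n) hz hz1).mul_left (n : ℝ))).add
    ((hasSum_ite_eq 1 ((δ - (n : ℝ) ^ 2) * z)).add (hasSum_ite_eq 2 (-δ * z ^ 2)))
  have hval : (n : ℝ) * ((n + 1).choose 2 : ℝ) * (1 / (1 - z) ^ n)
      - n * ((1 / (1 - z) ^ n - (1 + n * z)) / z ^ 2) + ((δ - (n : ℝ) ^ 2) * z + -δ * z ^ 2)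
      = (n : ℝ) * ((n : ℝ) * ((n : ℝ) + 1) * z ^ 2 - 2) / (2 * z ^ 2 * (1 - z) ^ n)
        - (n : ℝ) ^ 2 * z + (n : ℝ) * (1 + (n : ℝ) * z) / z ^ 2 + δ * (z - z ^ 2) := by
    rw [hN]
    field_simp
    ring
  rw [hval] at hmain
  have hsum : HasSum (fun k : ℕ => h k * z ^ k)
      ((n : ℝ) * ((n : ℝ) * ((n : ℝ) + 1) * z ^ 2 - 2) / (2 * z ^ 2 * (1 - z) ^ n)
        - (n : ℝ) ^ 2 * z + (n : ℝ) * (1 + (n : ℝ) * z) / z ^ 2 + δ * (z - z ^ 2)) := by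
    refine hmain.congr_fun fun k => ?_
    match k with
    | 0 => simp [h_0]
    | 1 =>
      rw [h_1, hN, cast_choose_add_two_three]
      simp
      ring
    | 2 =>
      rw [h_2]
      simp
      ring
    | k + 3 =>
      rw [h_ge3 (k + 3) (by omega)]
      simp
      ring
  refine ⟨fun h2 => ?_, fun h3 => ?_⟩
  · subst h2
    convert hsum using 1
    simp [hδ]
    field_simp
    ring
  · have : δ = 0 := if_neg (by omega)
    simpa [this] using hsum
end

section
/- (Poincaré function for metric connections, i.e. pairs (g,T) of a metric and a torsion, on an n-dimensional manifold.) Let n ≥ 2 and define h_0 = (1/2)·n·(n−1)^2 and h_k = (n(n+1)/2)·C(n+k, k+1) + (n^2(n−1)/2)·C(n+k−1, k) − n·C(n+k+1, k+2) for k ≥ 1. Then for every real z with 0 < |z| < 1, ∑_{k=0}^∞ h_k z^k = ( n − C(n,2)(z^2 − z) )/z^2 − ( 2n − n(n+1)z − n^2(n−1)z^2 ) / (2 z^2 (1−z)^n). -/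
/-- The generating function of the numbers `(n + j).choose j`. -/
theorem hasSum_add_choose_self_mul_geometric (n : ℕ) {z : ℝ} (hz : |z| < 1) :
    HasSum (fun j : ℕ => ((n + j).choose j : ℝ) * z ^ j) (1 / (1 - z) ^ (n + 1)) := by
  simpa only [Nat.add_comm n, Nat.choose_symm_add] using
    hasSum_choose_mul_geometric_of_norm_lt_one n hz


/-- Poincaré function for metric connections (pairs (g,T)) on an n-dimensional manifold, n ≥ 2. -/
theorem poincare_metric_connections (n : ℕ) (hn : 2 ≤ n) (h : ℕ → ℝ)
    (h_0 : h 0 = (1 / 2) * (n : ℝ) * ((n : ℝ) - 1) ^ 2)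
    (h_ge1 : ∀ k, 1 ≤ k → h k =
      ((n : ℝ) * ((n : ℝ) + 1) / 2) * ((n + k).choose (k + 1) : ℝ)
      + ((n : ℝ) ^ 2 * ((n : ℝ) - 1) / 2) * ((n + k - 1).choose k : ℝ)
      - (n : ℝ) * ((n + k + 1).choose (k + 2) : ℝ))
    (z : ℝ) (hz0 : 0 < |z|) (hz1 : |z| < 1) :
    HasSum (fun k : ℕ => h k * z ^ k)
      (((n : ℝ) - (n.choose 2 : ℝ) * (z ^ 2 - z)) / z ^ 2
        - (2 * (n : ℝ) - (n : ℝ) * ((n : ℝ) + 1) * z - (n : ℝ) ^ 2 * ((n : ℝ) - 1) * z ^ 2)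
          / (2 * z ^ 2 * (1 - z) ^ n)) := by
  obtain ⟨m, rfl⟩ : ∃ m, n = m + 1 := ⟨n - 1, by omega⟩
  have hz : z ≠ 0 := abs_pos.mp hz0
  have h1z : (1 - z) ^ (m + 1) ≠ 0 := pow_ne_zero _ (by linarith [(abs_lt.mp hz1).2])
  have hS := hasSum_add_choose_self_mul_geometric m hz1
  have hS₁ := ((hasSum_nat_add_iff' 1).mpr hS).mul_right z⁻¹
  have hS₂ := ((hasSum_nat_add_iff' 2).mpr hS).mul_right (z ^ 2)⁻¹
  have hcorr := hasSum_ite_eq (0 : ℕ) (-((m + 1 : ℝ) * m / 2))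
  have hchoose : ((m + 2).choose 2 : ℝ) = (m + 2) * (m + 1) / 2 := by
    rw [Nat.cast_choose_two]; push_cast; ring
  have htotal := (((hS₁.mul_left ((m + 1 : ℝ) * (m + 2) / 2)).add
    (hS.mul_left ((m + 1 : ℝ) ^ 2 * m / 2))).sub (hS₂.mul_left (m + 1 : ℝ))).add hcorr
  convert! htotal using 1
  · funext k
    rcases Nat.eq_zero_or_pos k with rfl | hk
    · rw [h_0]
      simp [hchoose]
      field_simp
      ring
    · rw [h_ge1 k hk, if_neg hk.ne', show m + 1 + k - 1 = m + k by omega,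
        show m + 1 + k = m + (k + 1) by omega, show m + (k + 1) + 1 = m + (k + 2) by omega]
      push_cast
      field_simp
      ring
  · rw [Nat.cast_choose_two]
    simp [Finset.sum_range_succ]
    field_simp
    ring
end

section
/- (Poincaré function for conformal structures on an n-dimensional manifold, n ≥ 3.) (i) Let n = 3 and h_0 = h_1 = h_2 = 0, h_3 = 1, h_4 = 9, h_k = k^2 − 4 for k ≥ 5; then for every real z with 0 < |z| < 1, ∑_{k=0}^∞ h_k z^k = z^3 (1+z)(1 + 5z − 8z^2 + 3z^3)/(1−z)^3. (ii) Let n ≥ 4 and h_0 = h_1 = 0, h_2 = n^2(n^2−1)/12 − n^2 − 1, h_3 = (1/24)·n·(n^4 + 2n^3 − 5n^2 − 14n − 32), and h_k = (C(n+1,2) − 1)·C(n+k−1, k) − n·C(n+k, k+1) for k ≥ 4; then for every real z with 0 < |z| < 1, ∑_{k=0}^∞ h_k z^k = ((n+1)nz − 2(n+z)) / (2z(1−z)^n) + n/z + (1 + C(n,2) + nz)(1 − z^2). -/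
/-- Changing finitely many terms of a series changes its sum by the sum of the changes. -/
theorem HasSum.add_sum_sub_of_eq_of_le {f g : ℕ → ℝ} {s : ℝ} (hf : HasSum f s) (N : ℕ)
    (hfg : ∀ k, N ≤ k → g k = f k) :
    HasSum g (s + ∑ k ∈ Finset.range N, (g k - f k)) := by
  have hd : HasSum (fun k => g k - f k) (∑ k ∈ Finset.range N, (g k - f k)) := by
    apply hasSum_sum_of_ne_finset_zero
    intro k hk
    rw [hfg k (by simpa using hk), sub_self]
  simpa using hf.add hd

theorem Nat.cast_add_two_choose_two (m : ℕ) :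
    ((m + 2).choose 2 : ℝ) = (m + 2) * (m + 1) / 2 := by
  rw [Nat.cast_choose_two]
  push_cast
  ring

theorem Nat.cast_add_three_choose_three (m : ℕ) :
    ((m + 3).choose 3 : ℝ) = (m + 3) * (m + 2) * (m + 1) / 6 := by
  have h : ((m + 2 + 1 : ℕ) : ℝ) * ((m + 2).choose 2 : ℝ) = ((m + 3).choose 3 : ℝ) * (2 + 1 : ℕ) :=
    mod_cast Nat.add_one_mul_choose_eq (m + 2) 2
  rw [Nat.cast_add_two_choose_two] at h
  push_cast at h
  linarith

theorem Nat.cast_add_four_choose_four (m : ℕ) :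
    ((m + 4).choose 4 : ℝ) = (m + 4) * (m + 3) * (m + 2) * (m + 1) / 24 := by
  have h : ((m + 3 + 1 : ℕ) : ℝ) * ((m + 3).choose 3 : ℝ) = ((m + 4).choose 4 : ℝ) * (3 + 1 : ℕ) :=
    mod_cast Nat.add_one_mul_choose_eq (m + 3) 3
  rw [Nat.cast_add_three_choose_three] at h
  push_cast at h
  linarith

/-- The generating function of `k ^ 2 - 4`. -/
theorem hasSum_sq_sub_four_mul_geometric {z : ℝ} (hz : |z| < 1) :
    HasSum (fun k : ℕ => ((k : ℝ) ^ 2 - 4) * z ^ k)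
      (2 * (1 / (1 - z) ^ 3) - 3 * (1 / (1 - z) ^ 2) - 3 * (1 / (1 - z))) := by
  have h2 := hasSum_choose_mul_geometric_of_norm_lt_one 2 (r := z) hz
  have h1 := hasSum_choose_mul_geometric_of_norm_lt_one 1 (r := z) hz
  have h0 := hasSum_choose_mul_geometric_of_norm_lt_one 0 (r := z) hz
  have h := ((h2.mul_left 2).sub (h1.mul_left 3)).sub (h0.mul_left 3)
  simp only [zero_add, pow_one, Nat.reduceAdd, Nat.cast_add_two_choose_two, Nat.choose_one_right,
    Nat.choose_zero_right] at h
  refine h.congr_fun fun k => ?_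
  push_cast
  ring

/-- The generating function of the binomial coefficients `(m + (k + 1)).choose (k + 1)`. -/
theorem hasSum_choose_succ_mul_geometric (m : ℕ) {z : ℝ} (hz₀ : z ≠ 0) (hz : |z| < 1) :
    HasSum (fun k : ℕ => ((m + (k + 1)).choose (k + 1) : ℝ) * z ^ k)
      ((1 / (1 - z) ^ (m + 1) - 1) / z) := by
  have h := hasSum_choose_mul_geometric_of_norm_lt_one m (r := z) hz
  rw [← hasSum_nat_add_iff' 1] at h
  have h' := h.div_const z
  simp only [Finset.sum_range_one, zero_add, Nat.choose_self, Nat.cast_one, pow_zero,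
    mul_one] at h'
  refine h'.congr_fun fun k => ?_
  rw [← Nat.choose_symm_add, add_comm m (k + 1)]
  field_simp
  ring

/-- Poincaré function for conformal structures on an n-dimensional manifold:
(i) the case n = 3, (ii) the case n ≥ 4. -/
theorem poincare_conformal_structures :
    (∀ h : ℕ → ℝ,
      h 0 = 0 → h 1 = 0 → h 2 = 0 → h 3 = 1 → h 4 = 9 →
      (∀ k, 5 ≤ k → h k = (k : ℝ) ^ 2 - 4) →
      ∀ z : ℝ, 0 < |z| → |z| < 1 →
        HasSum (fun k : ℕ => h k * z ^ k)
          (z ^ 3 * (1 + z) * (1 + 5 * z - 8 * z ^ 2 + 3 * z ^ 3) / (1 - z) ^ 3)) ∧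
    (∀ n : ℕ, 4 ≤ n → ∀ h : ℕ → ℝ,
      h 0 = 0 → h 1 = 0 →
      h 2 = (n : ℝ) ^ 2 * ((n : ℝ) ^ 2 - 1) / 12 - (n : ℝ) ^ 2 - 1 →
      h 3 = (1 / 24) * (n : ℝ) * ((n : ℝ) ^ 4 + 2 * (n : ℝ) ^ 3 - 5 * (n : ℝ) ^ 2
        - 14 * (n : ℝ) - 32) →
      (∀ k, 4 ≤ k → h k = (((n + 1).choose 2 : ℝ) - 1) * ((n + k - 1).choose k : ℝ)
        - (n : ℝ) * ((n + k).choose (k + 1) : ℝ)) →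
      ∀ z : ℝ, 0 < |z| → |z| < 1 →
        HasSum (fun k : ℕ => h k * z ^ k)
          ((((n : ℝ) + 1) * (n : ℝ) * z - 2 * ((n : ℝ) + z)) / (2 * z * (1 - z) ^ n)
            + (n : ℝ) / z + (1 + (n.choose 2 : ℝ) + (n : ℝ) * z) * (1 - z ^ 2))) := by
  refine ⟨?_, ?_⟩
  · intro h h0 h1 h2 h3 h4 hk z hz₀ hz
    have hz1 : 1 - z ≠ 0 := (sub_pos.mpr (abs_lt.mp hz).2).ne'
    have H := (hasSum_sq_sub_four_mul_geometric hz).add_sum_sub_of_eq_of_le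
      (g := fun k => h k * z ^ k) 5 (fun k hk5 => by rw [hk k hk5])
    convert H using 1
    simp only [Finset.sum_range_succ, Finset.sum_range_zero, h0, h1, h2, h3, h4]
    push_cast
    field_simp
    ring
  · intro n hn h h0 h1 h2 h3 hk z hz₀ hz
    have hz0 : z ≠ 0 := abs_pos.mp hz₀
    have hz1 : 1 - z ≠ 0 := (sub_pos.mpr (abs_lt.mp hz).2).ne'
    obtain ⟨m, rfl⟩ : ∃ m, n = m + 1 := ⟨n - 1, by omega⟩
    have hA := (hasSum_choose_mul_geometric_of_norm_lt_one m (r := z) hz).mul_left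
      (((m + 1 + 1).choose 2 : ℝ) - 1)
    have hB := (hasSum_choose_succ_mul_geometric m hz0 hz).mul_left ((m + 1 : ℕ) : ℝ)
    have H := (hA.sub hB).add_sum_sub_of_eq_of_le (g := fun k => h k * z ^ k) 4 (fun k hk4 => by
      rw [hk k hk4, show m + 1 + k - 1 = m + k by omega, show m + 1 + k = m + (k + 1) by omega,
        ← Nat.choose_symm_add, add_comm k m]
      ring)
    convert H using 1
    have c1 : ((m + 1).choose 2 : ℝ) = (m + 1) * m / 2 := by
      rw [Nat.cast_choose_two]
      push_cast
      ring
    have e1 : (1 + m).choose m = m + 1 := by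
      rw [← Nat.choose_symm_add, Nat.choose_one_right, add_comm]
    have e2 : (2 + m).choose m = (m + 2).choose 2 := by rw [← Nat.choose_symm_add, add_comm]
    have e3 : (3 + m).choose m = (m + 3).choose 3 := by rw [← Nat.choose_symm_add, add_comm]
    simp only [Finset.sum_range_succ, Finset.sum_range_zero, h0, h1, h2, h3, c1, e1, e2, e3,
      zero_add, Nat.reduceAdd, Nat.choose_self, Nat.choose_one_right, add_assoc,
      Nat.cast_add_two_choose_two, Nat.cast_add_three_choose_three,
      Nat.cast_add_four_choose_four]
    push_cast
    field_simp
    ring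
end

section
/- (Poincaré function for Einstein–Weyl structures on an n-dimensional manifold, n ≥ 3.) Let n ≥ 3 and define h_0 = 0, h_1 = (1/12)·(n−3)·n·(n+1)·(n+2) + δ, h_2 = (1/24)·n·(n−1)·(n−2)·(n^2 + 5n + 8) − δ, and h_k = (C(n+1,2) − 1)·C(n+k, k+1) + n·C(n+k−1, k) − (C(n+1,2) − 1)·C(n+k−2, k−1) − n·C(n+k+1, k+2) for k ≥ 3, where δ = 1 if n = 3 and δ = 0 if n ≥ 4. Then for every real z with 0 < |z| < 1: if n = 3, ∑_{k=0}^∞ h_k z^k = z(1 + 5z − z^2 − z^3)/(1−z)^2; if n ≥ 4, ∑_{k=0}^∞ h_k z^k = ( n z^2 − (C(n+1,2) − 1) z (z^2 − 1) − n ) / (z^2 (1−z)^n) − ( (C(n,2) + 1) z (z^2 − 1) − n )/z^2. -/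
/-- The negative binomial series `∑ C(m + k, k) z ^ k = (1 - z) ^ (-(m + 1))`, without its first
`j` terms. -/
lemma hasSum_choose_mul_pow_tail (m j : ℕ) {z : ℝ} (hz : |z| < 1) :
    HasSum (fun k : ℕ => ((m + (k + j)).choose (k + j) : ℝ) * z ^ (k + j))
      (1 / (1 - z) ^ (m + 1) - ∑ i ∈ Finset.range j, ((m + i).choose i : ℝ) * z ^ i) := by
  have hsum : HasSum (fun k : ℕ => ((m + k).choose k : ℝ) * z ^ k) (1 / (1 - z) ^ (m + 1)) := by
    refine (hasSum_choose_mul_geometric_of_norm_lt_one (𝕜 := ℝ) m (r := z) hz).congr_fun ?_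
    intro k
    rw [Nat.add_comm k m, Nat.choose_symm_add]
  exact (hasSum_nat_add_iff' j).2 hsum

lemma cast_choose_add_succ (m k : ℕ) :
    ((m + (k + 1)).choose (k + 1) : ℝ) = (m + k + 1) * ((m + k).choose k : ℝ) / (k + 1) := by
  rw [eq_div_iff (by positivity)]
  exact_mod_cast (Nat.add_one_mul_choose_eq (m + k) k).symm

/-- Poincaré function for Einstein–Weyl structures on an n-dimensional manifold, n ≥ 3. -/
theorem poincare_einstein_weyl (n : ℕ) (hn : 3 ≤ n) (h : ℕ → ℝ)
    (h_0 : h 0 = 0)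
    (h_1 : h 1 = (1 / 12) * ((n : ℝ) - 3) * (n : ℝ) * ((n : ℝ) + 1) * ((n : ℝ) + 2)
      + (if n = 3 then (1 : ℝ) else 0))
    (h_2 : h 2 = (1 / 24) * (n : ℝ) * ((n : ℝ) - 1) * ((n : ℝ) - 2)
      * ((n : ℝ) ^ 2 + 5 * (n : ℝ) + 8) - (if n = 3 then (1 : ℝ) else 0))
    (h_ge3 : ∀ k, 3 ≤ k → h k = (((n + 1).choose 2 : ℝ) - 1) * ((n + k).choose (k + 1) : ℝ)
      + (n : ℝ) * ((n + k - 1).choose k : ℝ)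
      - (((n + 1).choose 2 : ℝ) - 1) * ((n + k - 2).choose (k - 1) : ℝ)
      - (n : ℝ) * ((n + k + 1).choose (k + 2) : ℝ))
    (z : ℝ) (hz0 : 0 < |z|) (hz1 : |z| < 1) :
    (n = 3 → HasSum (fun k : ℕ => h k * z ^ k)
      (z * (1 + 5 * z - z ^ 2 - z ^ 3) / (1 - z) ^ 2)) ∧
    (4 ≤ n → HasSum (fun k : ℕ => h k * z ^ k)
      (((n : ℝ) * z ^ 2 - (((n + 1).choose 2 : ℝ) - 1) * z * (z ^ 2 - 1) - (n : ℝ))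
          / (z ^ 2 * (1 - z) ^ n)
        - (((n.choose 2 : ℝ) + 1) * z * (z ^ 2 - 1) - (n : ℝ)) / z ^ 2)) := by

  have hz : z ≠ 0 := abs_pos.1 hz0
  have hz' : 1 - z ≠ 0 := sub_ne_zero.2 (lt_of_abs_lt hz1).ne'
  obtain ⟨m, rfl⟩ : ∃ m, n = m + 1 := ⟨n - 1, by omega⟩
  have hN : (((m + 1 + 1).choose 2 : ℕ) : ℝ) = (m + 2) * (m + 1) / 2 := by
    rw [Nat.cast_choose_two]; push_cast; ring
  have hC : (((m + 1).choose 2 : ℕ) : ℝ) = (m + 1) * m / 2 := by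
    rw [Nat.cast_choose_two]; push_cast; ring
  rw [hN] at h_ge3 ⊢
  rw [hC]
  set δ : ℝ := if m + 1 = 3 then 1 else 0 with hδ
  have tail : HasSum (fun k : ℕ => h (k + 3) * z ^ (k + 3)) _ :=
    (((((hasSum_choose_mul_pow_tail m 4 hz1).mul_left (((m + 2) * (m + 1) / 2 - 1) / z)).add
      ((hasSum_choose_mul_pow_tail m 3 hz1).mul_left ((m : ℝ) + 1))).sub
      ((hasSum_choose_mul_pow_tail m 2 hz1).mul_left (((m + 2) * (m + 1) / 2 - 1) * z))).sub
      ((hasSum_choose_mul_pow_tail m 5 hz1).mul_left (((m : ℝ) + 1) / z ^ 2))).congr_fun (by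
        intro k
        rw [h_ge3 (k + 3) (by omega),
          show m + 1 + (k + 3) = m + (k + 4) by ring,
          show m + (k + 4) - 1 = m + (k + 3) by omega,
          show m + (k + 4) - 2 = m + (k + 2) by omega,
          show m + (k + 4) + 1 = m + (k + 5) by ring,
          show k + 3 - 1 = k + 2 by omega]
        push_cast
        field_simp
        ring)
  have total : HasSum (fun k : ℕ => h k * z ^ k)
      ((((m : ℝ) + 1) * z ^ 2 - ((m + 2) * (m + 1) / 2 - 1) * z * (z ^ 2 - 1) - (m + 1))
          / (z ^ 2 * (1 - z) ^ (m + 1))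
        - (((m + 1) * m / 2 + 1) * z * (z ^ 2 - 1) - (m + 1)) / z ^ 2 + δ * (z - z ^ 2)) := by
    refine (hasSum_nat_add_iff' 3).1 (Eq.mp (congrArg (HasSum _ · _) ?_) tail)
    simp only [Finset.sum_range_succ, Finset.sum_range_zero, cast_choose_add_succ, h_0, h_1, h_2,
      Nat.choose_zero_right]
    push_cast
    field_simp
    ring
  constructor
  · intro h3
    obtain rfl : m = 2 := by omega
    convert total using 1
    norm_num [hδ]
    field_simp
    ring
  · intro h4
    have : δ = 0 := if_neg (by omega)
    convert total using 1
    rw [this]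
    push_cast
    ring
end

section
/- (Poincaré function for almost complex structures on a 2n-dimensional manifold.) (i) Let n = 2 and h_0 = h_1 = 0, h_2 = 2, h_k = 8·C(k+3, k) − 4·C(k+4, k+1) + 4 for k ≥ 3; then for every real z with 0 < |z| < 1, ∑_{k=0}^∞ h_k z^k = 2 z^2 (1 + 8z − 12z^2 + 6z^3 − z^4)/(1−z)^4. (ii) Let n = 3 and h_0 = 0, h_k = 2n^2·C(2n+k−1, k) − 2n·C(2n+k, k+1) + 2n·C(n+k, k+1) − 2n·C(n+k−1, k) + 2·(δ_{k,1} − δ_{k,2}) for k ≥ 1 (δ the Kronecker delta); then for every real z with 0 < |z| < 1, ∑_{k=0}^∞ h_k z^k = 2z(1 + 26z − 36z^2 + 10z^3 + 17z^4 − 18z^5 + 7z^6 − z^7)/(1−z)^6. (iii) Let n ≥ 4 and h_0 = 0, h_k = 2n^2·C(2n+k−1, k) − 2n·C(2n+k, k+1) + 2n·C(n+k, k+1) − 2n·C(n+k−1, k) for k ≥ 1; then for every real z with 0 < |z| < 1, ∑_{k=0}^∞ h_k z^k = 2n(nz − 1)/(z (1−z)^{2n}) + 2n/(z (1−z)^{n−1})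 + 2n. -/
theorem hasSum_add_choose_mul_geometric (m : ℕ) {z : ℝ} (hz : |z| < 1) :
    HasSum (fun k : ℕ => ((k + m).choose k : ℝ) * z ^ k) (1 / (1 - z) ^ (m + 1)) := by
  simpa only [Nat.choose_symm_add] using
    hasSum_choose_mul_geometric_of_norm_lt_one m (r := z) (by simpa using hz)

theorem hasSum_add_choose_succ_mul_geometric (m : ℕ) {z : ℝ} (hz₀ : z ≠ 0) (hz : |z| < 1) :
    HasSum (fun k : ℕ => ((k + 1 + m).choose (k + 1) : ℝ) * z ^ k)
      ((1 / (1 - z) ^ (m + 1) - 1) / z) := by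
  have hs := ((hasSum_nat_add_iff' 1).mpr (hasSum_add_choose_mul_geometric m hz)).div_const z
  simp only [Finset.sum_range_one, Nat.choose_zero_right, Nat.cast_one, pow_zero, mul_one] at hs
  refine hs.congr_fun fun k => ?_
  rw [pow_succ, ← mul_assoc, mul_div_cancel_right₀ _ hz₀]

theorem hasSum_choose_combination_mul_geometric (n : ℕ) (hn : 1 ≤ n) {z : ℝ} (hz₀ : z ≠ 0)
    (hz : |z| < 1) :
    HasSum (fun k : ℕ => (2 * (n : ℝ) ^ 2 * ((2 * n + k - 1).choose k : ℝ)
        - 2 * (n : ℝ) * ((2 * n + k).choose (k + 1) : ℝ)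
        + 2 * (n : ℝ) * ((n + k).choose (k + 1) : ℝ)
        - 2 * (n : ℝ) * ((n + k - 1).choose k : ℝ)) * z ^ k)
      (2 * (n : ℝ) * ((n : ℝ) * z - 1) / (z * (1 - z) ^ (2 * n))
        + 2 * (n : ℝ) / (z * (1 - z) ^ (n - 1))) := by
  obtain ⟨m, rfl⟩ := Nat.exists_eq_add_of_le' hn
  have hz₁ : 1 - z ≠ 0 := sub_ne_zero.mpr (lt_of_abs_lt hz).ne'
  have hs := ((((hasSum_add_choose_mul_geometric (2 * m + 1) hz).mul_left
      (2 * ((m + 1 : ℕ) : ℝ) ^ 2)).sub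
    ((hasSum_add_choose_succ_mul_geometric (2 * m + 1) hz₀ hz).mul_left
      (2 * ((m + 1 : ℕ) : ℝ)))).add
    ((hasSum_add_choose_succ_mul_geometric m hz₀ hz).mul_left (2 * ((m + 1 : ℕ) : ℝ)))).sub
    ((hasSum_add_choose_mul_geometric m hz).mul_left (2 * ((m + 1 : ℕ) : ℝ)))
  convert! hs using 1
  · funext k
    rw [show 2 * (m + 1) + k - 1 = k + (2 * m + 1) by omega,
      show 2 * (m + 1) + k = k + 1 + (2 * m + 1) by omega,
      show m + 1 + k - 1 = k + m by omega, show m + 1 + k = k + 1 + m by omega]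
    ring
  · rw [Nat.add_sub_cancel]
    field_simp
    ring


/-- Poincaré function for almost complex structures on a 2n-dimensional manifold:
(i) the case n = 2, (ii) the case n = 3, (iii) the case n ≥ 4. -/
theorem poincare_almost_complex :
    (∀ h : ℕ → ℝ,
      h 0 = 0 → h 1 = 0 → h 2 = 2 →
      (∀ k, 3 ≤ k → h k = 8 * ((k + 3).choose k : ℝ) - 4 * ((k + 4).choose (k + 1) : ℝ) + 4) →
      ∀ z : ℝ, 0 < |z| → |z| < 1 →
        HasSum (fun k : ℕ => h k * z ^ k)
          (2 * z ^ 2 * (1 + 8 * z - 12 * z ^ 2 + 6 * z ^ 3 - z ^ 4) / (1 - z) ^ 4)) ∧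
    (∀ h : ℕ → ℝ,
      h 0 = 0 →
      (∀ k, 1 ≤ k → h k = 2 * (3 : ℝ) ^ 2 * ((2 * 3 + k - 1).choose k : ℝ)
        - 2 * 3 * ((2 * 3 + k).choose (k + 1) : ℝ) + 2 * 3 * ((3 + k).choose (k + 1) : ℝ)
        - 2 * 3 * ((3 + k - 1).choose k : ℝ)
        + 2 * ((if k = 1 then (1 : ℝ) else 0) - (if k = 2 then (1 : ℝ) else 0))) →
      ∀ z : ℝ, 0 < |z| → |z| < 1 →
        HasSum (fun k : ℕ => h k * z ^ k)
          (2 * z * (1 + 26 * z - 36 * z ^ 2 + 10 * z ^ 3 + 17 * z ^ 4 - 18 * z ^ 5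
            + 7 * z ^ 6 - z ^ 7) / (1 - z) ^ 6)) ∧
    (∀ n : ℕ, 4 ≤ n → ∀ h : ℕ → ℝ,
      h 0 = 0 →
      (∀ k, 1 ≤ k → h k = 2 * (n : ℝ) ^ 2 * ((2 * n + k - 1).choose k : ℝ)
        - 2 * (n : ℝ) * ((2 * n + k).choose (k + 1) : ℝ)
        + 2 * (n : ℝ) * ((n + k).choose (k + 1) : ℝ)
        - 2 * (n : ℝ) * ((n + k - 1).choose k : ℝ)) →
      ∀ z : ℝ, 0 < |z| → |z| < 1 →
        HasSum (fun k : ℕ => h k * z ^ k)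
          (2 * (n : ℝ) * ((n : ℝ) * z - 1) / (z * (1 - z) ^ (2 * n))
            + 2 * (n : ℝ) / (z * (1 - z) ^ (n - 1)) + 2 * (n : ℝ))) := by
  refine ⟨fun h h0 h1 h2 hk z hz₀ hz => ?_, fun h h0 hk z hz₀ hz => ?_,
    fun n hn h h0 hk z hz₀ hz => ?_⟩
  all_goals
    have hz₀' : z ≠ 0 := abs_pos.mp hz₀
    have hz₁ : 1 - z ≠ 0 := sub_ne_zero.mpr (lt_of_abs_lt hz).ne'
  · have hs := (((((hasSum_add_choose_mul_geometric 3 hz).mul_left 8).sub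
      ((hasSum_add_choose_succ_mul_geometric 3 hz₀' hz).mul_left 4)).add
      ((hasSum_geometric_of_abs_lt_one hz).mul_left 4)).add
      (hasSum_ite_eq 0 4)).add ((hasSum_ite_eq 1 (4 * z)).add (hasSum_ite_eq 2 (-2 * z ^ 2)))
    convert! hs using 1
    · funext k
      match k with
      | 0 => norm_num [h0, Nat.choose]
      | 1 => norm_num [h1, Nat.choose]; ring
      | 2 => norm_num [h2, Nat.choose]; ring
      | k + 3 =>
        rw [hk _ (by omega), show k + 3 + 1 + 3 = k + 3 + 4 by omega]
        simp
        ring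
    · field_simp
      ring
  · have hs := ((hasSum_choose_combination_mul_geometric 3 (by norm_num) hz₀' hz).add
      (hasSum_ite_eq 0 6)).add ((hasSum_ite_eq 1 (2 * z)).add (hasSum_ite_eq 2 (-2 * z ^ 2)))
    convert! hs using 1
    · funext k
      match k with
      | 0 => norm_num [h0]
      | 1 => norm_num [hk, Nat.choose]
      | 2 => norm_num [hk, Nat.choose]; ring
      | k + 3 =>
        rw [hk _ (by omega)]
        simp
    · norm_num
      field_simp
      ring
  · have hs := (hasSum_choose_combination_mul_geometric n (by omega) hz₀' hz).add
      (hasSum_ite_eq 0 (2 * (n : ℝ)))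
    refine hs.congr_fun fun k => ?_
    rcases Nat.eq_zero_or_pos k with rfl | hk₀
    · simp [h0]
      ring
    · simp [hk k hk₀, hk₀.ne']
end
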